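/- arXiv:2602.07288 — 6 statements merged into one kernel-verified Lean document; each statement's English description precedes it below -/
import Mathlib

section
/- Let n ≥ 1 and let φ : ℝⁿ → ℝ be a convex function (finite everywhere). Then the lower limit of (φ(x) − φ(0))/‖x‖₂ as ‖x‖₂ → ∞ equals the infimum over unit vectors u (with ‖u‖₂ = 1) of the supremum over t > 0 of (φ(t·u) − φ(0))/t; that is, liminf_{‖x‖₂→∞} (φ(x) − φ(0))/‖x‖₂ = inf_{‖u‖₂=1} sup_{t>0} (φ(t·u) − φ(0))/t, where both sides are taken as values in the extended reals. -/
open Filter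

section ConvexSlope

variable {E : Type*} [NormedAddCommGroup E] [NormedSpace ℝ E] {φ : E → ℝ}

/-- The difference quotient at the origin of a convex function is monotone along each ray. -/
theorem ConvexOn.sub_zero_div_le_sub_zero_div (hφ : ConvexOn ℝ Set.univ φ) (u : E) {t s : ℝ}
    (ht : 0 < t) (hts : t ≤ s) : (φ (t • u) - φ 0) / t ≤ (φ (s • u) - φ 0) / s := by
  have hs : 0 < s := ht.trans_le hts
  have h := hφ.2 (Set.mem_univ (0 : E)) (Set.mem_univ (s • u))
    (sub_nonneg.2 ((div_le_one hs).2 hts)) (div_nonneg ht.le hs.le) (sub_add_cancel 1 (t / s))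
  rw [smul_zero, zero_add, smul_smul, div_mul_cancel₀ t hs.ne', smul_eq_mul, smul_eq_mul] at h
  rw [div_le_div_iff₀ ht hs]
  calc (φ (t • u) - φ 0) * s
      ≤ (t / s * (φ (s • u) - φ 0)) * s := by gcongr; linarith
    _ = (φ (s • u) - φ 0) * t := by field_simp

theorem liminf_sub_zero_div_norm_le (u : E) (hu : ‖u‖ = 1) :
    liminf (fun x : E => (((φ x - φ 0) / ‖x‖ : ℝ) : EReal)) (comap (fun x : E => ‖x‖) atTop)
      ≤ ⨆ t ∈ Set.Ioi (0 : ℝ), (((φ (t • u) - φ 0) / t : ℝ) : EReal) := by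
  have hnorm : ∀ t : ℝ, 0 < t → ‖t • u‖ = t := fun t ht => by
    rw [norm_smul, hu, mul_one, Real.norm_of_nonneg ht.le]
  have hray : Tendsto (fun t : ℝ => t • u) atTop (comap (fun x : E => ‖x‖) atTop) := by
    refine tendsto_comap_iff.2 (tendsto_id.congr' ?_)
    filter_upwards [eventually_gt_atTop 0] with t ht using (hnorm t ht).symm
  refine liminf_le_of_frequently_le' (hray.frequently (Eventually.frequently ?_))
  filter_upwards [eventually_gt_atTop 0] with t ht
  rw [hnorm t ht]
  exact le_iSup₂ (f := fun (t : ℝ) (_ : t ∈ Set.Ioi (0 : ℝ)) =>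
    (((φ (t • u) - φ 0) / t : ℝ) : EReal)) t ht

/-- If every ray through the unit sphere attains slope above `c`, then by compactness all of them
stay above `c` from a common radius on. -/
theorem ConvexOn.eventually_forall_sphere_lt [FiniteDimensional ℝ E] (hφ : ConvexOn ℝ Set.univ φ)
    {c : EReal} (hc : ∀ u : E, ‖u‖ = 1 → ∃ t : ℝ, 0 < t ∧ c < ((φ (t • u) - φ 0) / t : ℝ)) :
    ∀ᶠ s : ℝ in atTop, ∀ u ∈ Metric.sphere (0 : E) 1, c < ((φ (s • u) - φ 0) / s : ℝ) := by
  have hcont : Continuous φ := continuousOn_univ.1 (hφ.continuousOn isOpen_univ)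
  have : ProperSpace E := FiniteDimensional.proper ℝ E
  refine (isCompact_sphere (0 : E) 1).induction_on
    (p := fun S => ∀ᶠ s : ℝ in atTop, ∀ u ∈ S, c < ((φ (s • u) - φ 0) / s : ℝ)) (by simp)
    (fun S S' hS h => h.mono fun s hs u hu => hs u (hS hu))
    (fun S S' h h' => by
      filter_upwards [h, h'] with s hs hs' u hu using hu.elim (hs u) (hs' u)) fun u hu => ?_
  obtain ⟨t, ht, hlt⟩ := hc u (mem_sphere_zero_iff_norm.1 hu)
  have hq : Continuous fun v : E => (((φ (t • v) - φ 0) / t : ℝ) : EReal) :=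
    continuous_coe_real_ereal.comp (by fun_prop)
  refine ⟨_, mem_nhdsWithin_of_mem_nhds ((isOpen_lt continuous_const hq).mem_nhds hlt), ?_⟩
  filter_upwards [eventually_ge_atTop t] with s hs v hv
  exact lt_of_lt_of_le hv (EReal.coe_le_coe_iff.2 (hφ.sub_zero_div_le_sub_zero_div v ht hs))

end ConvexSlope

/-- For a (finite-valued) convex `φ : ℝⁿ → ℝ` with `n ≥ 1`,
`liminf_{‖x‖→∞} (φ(x) − φ(0))/‖x‖ = inf_{‖u‖=1} sup_{t>0} (φ(t•u) − φ(0))/t`,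
both sides taken in the extended reals. -/
theorem stmt3 (n : ℕ) (hn : 1 ≤ n) (φ : EuclideanSpace ℝ (Fin n) → ℝ)
    (hφ : ConvexOn ℝ Set.univ φ) :
    Filter.liminf
        (fun x : EuclideanSpace ℝ (Fin n) => (((φ x - φ 0) / ‖x‖ : ℝ) : EReal))
        (Filter.comap (fun x : EuclideanSpace ℝ (Fin n) => ‖x‖) Filter.atTop)
      = ⨅ u ∈ {u : EuclideanSpace ℝ (Fin n) | ‖u‖ = 1},
          ⨆ t ∈ Set.Ioi (0 : ℝ), (((φ (t • u) - φ 0) / t : ℝ) : EReal) := by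
  refine le_antisymm (le_iInf₂ fun u hu => liminf_sub_zero_div_norm_le u hu)
    (le_of_forall_lt fun c hc => ?_)
  obtain ⟨d, hcd, hd⟩ := exists_between hc
  refine hcd.trans_le (le_liminf_of_le (h := ?_))
  have hslope : ∀ u : EuclideanSpace ℝ (Fin n), ‖u‖ = 1 →
      ∃ t : ℝ, 0 < t ∧ d < ((φ (t • u) - φ 0) / t : ℝ) := fun u hu => by
    have h := hd.trans_le (iInf₂_le u hu)
    simp only [lt_iSup_iff] at h
    obtain ⟨t, ht, h⟩ := h
    exact ⟨t, ht, h⟩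
  filter_upwards [tendsto_comap.eventually (hφ.eventually_forall_sphere_lt hslope),
    tendsto_comap.eventually (eventually_gt_atTop (0 : ℝ))] with x hx hpos
  have h := hx (‖x‖⁻¹ • x) (mem_sphere_zero_iff_norm.2 (by
    rw [norm_smul, norm_inv, norm_norm, inv_mul_cancel₀ hpos.ne']))
  rw [smul_inv_smul₀ hpos.ne'] at h
  exact h.le
end

section
/- Let n ≥ 1 and let φ : ℝⁿ → ℝ be convex, even (φ(x) = φ(−x) for all x), and coercive (φ(x) → ∞ as ‖x‖₂ → ∞). Then m_φ := liminf_{‖x‖₂→∞} (φ(x) − φ(0))/‖x‖₂ > 0. -/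
open Filter

/-- A convex function that exceeds `φ 0 + 1` on the sphere of radius `R` grows at least linearly,
with slope `1 / R`, outside the ball of radius `R`. -/
theorem ConvexOn.one_div_le_slope_of_one_le_sphere {E : Type*} [NormedAddCommGroup E]
    [NormedSpace ℝ E] {φ : E → ℝ} (hφ : ConvexOn ℝ Set.univ φ) {R : ℝ} (hR : 0 < R)
    (hsphere : ∀ y, ‖y‖ = R → φ 0 + 1 ≤ φ y) {x : E} (hx : R ≤ ‖x‖) :
    1 / R ≤ (φ x - φ 0) / ‖x‖ := by
  have hx0 : 0 < ‖x‖ := hR.trans_le hx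
  have hy : φ 0 + 1 ≤ φ ((R / ‖x‖) • x) := by
    apply hsphere
    rw [norm_smul, Real.norm_of_nonneg (by positivity), div_mul_cancel₀ _ hx0.ne']
  have hc := hφ.2 (Set.mem_univ x) (Set.mem_univ 0) (div_nonneg hR.le hx0.le)
    (sub_nonneg.2 ((div_le_one hx0).2 hx)) (add_sub_cancel _ _)
  simp only [smul_zero, add_zero, smul_eq_mul] at hc
  have h : 1 ≤ (φ x - φ 0) / ‖x‖ * R := by
    have : (φ x - φ 0) / ‖x‖ * R = R / ‖x‖ * (φ x - φ 0) := by ring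
    rw [this]
    linarith
  exact (div_le_iff₀ hR).2 h

/-- If `φ : ℝⁿ → ℝ` (with `n ≥ 1`) is convex, even and coercive, then
`m_φ := liminf_{‖x‖→∞} (φ(x) − φ(0))/‖x‖ > 0` (in the extended reals). -/
theorem stmt5 (n : ℕ) (hn : 1 ≤ n) (φ : EuclideanSpace ℝ (Fin n) → ℝ)
    (hconv : ConvexOn ℝ Set.univ φ)
    (heven : ∀ x : EuclideanSpace ℝ (Fin n), φ x = φ (-x))
    (hcoercive : Filter.Tendsto φ
      (Filter.comap (fun x : EuclideanSpace ℝ (Fin n) => ‖x‖) Filter.atTop) Filter.atTop) :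
    (0 : EReal) < Filter.liminf
      (fun x : EuclideanSpace ℝ (Fin n) => (((φ x - φ 0) / ‖x‖ : ℝ) : EReal))
      (Filter.comap (fun x : EuclideanSpace ℝ (Fin n) => ‖x‖) Filter.atTop) := by
  obtain ⟨s, hs, hsub⟩ := mem_comap.1 (hcoercive.eventually_ge_atTop (φ 0 + 1))
  obtain ⟨R₀, hR₀⟩ := mem_atTop_sets.1 hs
  have hR : 0 < max R₀ 1 := lt_max_of_lt_right one_pos
  have hslope : ∀ᶠ x : EuclideanSpace ℝ (Fin n) in comap (fun x => ‖x‖) atTop,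
      ((1 / max R₀ 1 : ℝ) : EReal) ≤ (((φ x - φ 0) / ‖x‖ : ℝ) : EReal) := by
    filter_upwards [tendsto_comap.eventually_ge_atTop (max R₀ 1)] with x hx
    refine EReal.coe_le_coe_iff.2 (hconv.one_div_le_slope_of_one_le_sphere hR (fun y hy => ?_) hx)
    exact hsub (hR₀ _ ((le_max_left _ _).trans_eq hy.symm))
  exact (EReal.coe_pos.2 (one_div_pos.2 hR)).trans_le (le_liminf_of_le (by isBoundedDefault) hslope)
end

section
/- Let φ : ℝⁿ → ℝ be convex and nonnegative, let μ be a probability measure on ℝⁿ with ∫ w dμ(w) = 0 (the Bochner integral of the identity is zero), such that w ↦ φ(x + w) is μ-integrable for every x and ∫ φ(2w) dμ(w) < ∞. Define φ_μ(x) = ∫ φ(x + w) dμ(w). Then for every unit vector u ∈ ℝⁿ, the limits lim_{t→∞} φ(t·u)/t and lim_{t→∞} φ_μ(t·u)/t exist in [0, ∞] and are equal. -/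
open MeasureTheory Filter

/-- The difference quotient at the origin of a convex function along a ray has a limit at
infinity, finite or `+∞`. -/
theorem ConvexOn.tendsto_slope_atTop {f : ℝ → ℝ} (hf : ConvexOn ℝ Set.univ f) :
    Tendsto (fun t => (f t - f 0) / t) atTop atTop ∨
      ∃ l, Tendsto (fun t => (f t - f 0) / t) atTop (nhds l) := by
  have hmono : Monotone fun t : ℝ => (f (max t 1) - f 0) / max t 1 := by
    intro s t hst
    have hs : (0 : ℝ) < max s 1 := lt_max_of_lt_right one_pos
    have hle : max s 1 ≤ max t 1 := max_le_max_right 1 hst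
    have h := hf.secant_mono (a := 0) (x := max s 1) (y := max t 1) trivial trivial trivial
      hs.ne' (hs.trans_le hle).ne' hle
    simpa only [sub_zero] using h
  have heq : (fun t : ℝ => (f (max t 1) - f 0) / max t 1) =ᶠ[atTop]
      fun t => (f t - f 0) / t := by
    filter_upwards [eventually_ge_atTop (1 : ℝ)] with t ht
    rw [max_eq_left ht]
  exact (tendsto_atTop_of_monotone hmono).imp (fun h => h.congr' heq)
    fun ⟨l, h⟩ => ⟨l, h.congr' heq⟩

/-- The ratio `f t / t` of a convex function has a limit at infinity, finite or `+∞`. -/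
theorem ConvexOn.tendsto_div_id_atTop {f : ℝ → ℝ} (hf : ConvexOn ℝ Set.univ f) :
    Tendsto (fun t => f t / t) atTop atTop ∨
      ∃ l, Tendsto (fun t => f t / t) atTop (nhds l) := by
  have hzero : Tendsto (fun t : ℝ => f 0 / t) atTop (nhds 0) :=
    tendsto_const_nhds.div_atTop tendsto_id
  have heq : ∀ t : ℝ, (f t - f 0) / t + f 0 / t = f t / t := fun t => by ring
  refine hf.tendsto_slope_atTop.imp (fun h => ?_) fun ⟨l, h⟩ => ⟨l, ?_⟩
  · exact (h.atTop_add hzero).congr heq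
  · simpa only [heq, add_zero] using h.add hzero

/-- Jensen's inequality for averaging a convex function against a centred measure. -/
theorem ConvexOn.le_integral_add {E : Type*} [NormedAddCommGroup E] [NormedSpace ℝ E]
    [FiniteDimensional ℝ E] [MeasurableSpace E] {φ : E → ℝ} (hφ : ConvexOn ℝ Set.univ φ)
    {μ : Measure E} [IsProbabilityMeasure μ] (hid : Integrable (fun w : E => w) μ)
    (hmean : ∫ w, w ∂μ = 0) (x : E) (hint : Integrable (fun w => φ (x + w)) μ) :
    φ x ≤ ∫ w, φ (x + w) ∂μ := by
  have h := hφ.map_integral_le (f := fun w => x + w) (μ := μ)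
    (hφ.continuousOn isOpen_univ) isClosed_univ (by simp)
    ((integrable_const x).add hid) hint
  rwa [integral_add (integrable_const x) hid, hmean, integral_const, probReal_univ, one_smul,
    add_zero] at h

/-- A convex function at a sum is at most the mean of its values at the doubled summands. -/
theorem ConvexOn.map_add_le_half {E : Type*} [AddCommGroup E] [Module ℝ E] {φ : E → ℝ}
    (hφ : ConvexOn ℝ Set.univ φ) (x w : E) :
    φ (x + w) ≤ (1 / 2) * φ ((2 : ℝ) • x) + (1 / 2) * φ ((2 : ℝ) • w) := by
  have h := hφ.2 (Set.mem_univ ((2 : ℝ) • x)) (Set.mem_univ ((2 : ℝ) • w))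
    one_half_pos.le one_half_pos.le (add_halves 1)
  simpa [smul_smul] using h

/-- Averaging a convex function against a probability measure increases it by at most doubling
the argument, up to a constant. -/
theorem ConvexOn.integral_add_le {E : Type*} [AddCommGroup E] [Module ℝ E] [MeasurableSpace E]
    {φ : E → ℝ} (hφ : ConvexOn ℝ Set.univ φ) {μ : Measure E} [IsProbabilityMeasure μ] (x : E)
    (hint : Integrable (fun w => φ (x + w)) μ)
    (h2 : Integrable (fun w => φ ((2 : ℝ) • w)) μ) :
    ∫ w, φ (x + w) ∂μ ≤ (1 / 2) * φ ((2 : ℝ) • x) + (1 / 2) * ∫ w, φ ((2 : ℝ) • w) ∂μ := by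
  have h := integral_mono hint ((integrable_const ((1 / 2) * φ ((2 : ℝ) • x))).add
    (h2.const_mul (1 / 2))) fun w => hφ.map_add_le_half x w
  rwa [integral_add' (integrable_const _) (h2.const_mul _), integral_const, probReal_univ,
    one_smul, integral_const_mul] at h

/-- For a nonnegative convex `φ : ℝⁿ → ℝ` and a mean-zero probability
measure `μ` with the stated integrability, the limits `lim_{t→∞} φ(t•u)/t` and
`lim_{t→∞} φ_μ(t•u)/t` exist in `[0, ∞]` and are equal, for every unit vector `u`. -/
theorem stmt6 (n : ℕ) (φ : EuclideanSpace ℝ (Fin n) → ℝ)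
    (hconv : ConvexOn ℝ Set.univ φ)
    (hnonneg : ∀ x : EuclideanSpace ℝ (Fin n), 0 ≤ φ x)
    (μ : Measure (EuclideanSpace ℝ (Fin n))) [IsProbabilityMeasure μ]
    (hid : Integrable (fun w : EuclideanSpace ℝ (Fin n) => w) μ)
    (hmean : ∫ w, w ∂μ = (0 : EuclideanSpace ℝ (Fin n)))
    (hint : ∀ x : EuclideanSpace ℝ (Fin n), Integrable (fun w => φ (x + w)) μ)
    (h2w : Integrable (fun w : EuclideanSpace ℝ (Fin n) => φ ((2 : ℝ) • w)) μ)
    (φμ : EuclideanSpace ℝ (Fin n) → ℝ)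
    (hφμ : ∀ x : EuclideanSpace ℝ (Fin n), φμ x = ∫ w, φ (x + w) ∂μ)
    (u : EuclideanSpace ℝ (Fin n)) (hu : ‖u‖ = 1) :
    ∃ L : EReal, 0 ≤ L ∧
      Filter.Tendsto (fun t : ℝ => ((φ (t • u) / t : ℝ) : EReal)) Filter.atTop (nhds L) ∧
      Filter.Tendsto (fun t : ℝ => ((φμ (t • u) / t : ℝ) : EReal)) Filter.atTop (nhds L) := by
  have hray : ConvexOn ℝ Set.univ fun t : ℝ => φ (t • u) :=
    hconv.comp_linearMap (LinearMap.toSpanSingleton ℝ _ u)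
  have hlower : ∀ᶠ t : ℝ in atTop, φ (t • u) / t ≤ φμ (t • u) / t := by
    filter_upwards [eventually_gt_atTop 0] with t ht
    rw [hφμ]
    gcongr
    exact hconv.le_integral_add hid hmean _ (hint _)
  obtain htop | ⟨l, hl⟩ := hray.tendsto_div_id_atTop
  · exact ⟨⊤, le_top, EReal.tendsto_coe_nhds_top_iff.2 htop,
      EReal.tendsto_coe_nhds_top_iff.2 (tendsto_atTop_mono' _ hlower htop)⟩
  · have hl0 : 0 ≤ l := by
      refine ge_of_tendsto hl ?_
      filter_upwards [eventually_ge_atTop 0] with t ht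
      exact div_nonneg (hnonneg _) ht
    set C := (1 / 2) * ∫ w, φ ((2 : ℝ) • w) ∂μ
    have hupper : ∀ᶠ t : ℝ in atTop,
        φμ (t • u) / t ≤ φ ((2 * t) • u) / (2 * t) + C / t := by
      filter_upwards [eventually_gt_atTop 0] with t ht
      have h := hconv.integral_add_le (t • u) (hint _) h2w
      rw [← hφμ, smul_smul] at h
      calc φμ (t • u) / t ≤ ((1 / 2) * φ ((2 * t) • u) + C) / t := by gcongr
        _ = φ ((2 * t) • u) / (2 * t) + C / t := by field_simp
    have hbound : Tendsto (fun t : ℝ => φ ((2 * t) • u) / (2 * t) + C / t) atTop (nhds l) := by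
      simpa using (hl.comp (tendsto_id.const_mul_atTop two_pos)).add
        (tendsto_const_nhds.div_atTop tendsto_id : Tendsto (fun t : ℝ => C / t) atTop (nhds 0))
    exact ⟨l, EReal.coe_nonneg.2 hl0, EReal.tendsto_coe.2 hl,
      EReal.tendsto_coe.2 (tendsto_of_tendsto_of_tendsto_of_le_of_le' hl hbound hlower hupper)⟩
end

section
/- Let n ≥ 1, let φ : ℝⁿ → ℝ be convex, even, coercive, and nonnegative, and let μ be a probability measure on ℝⁿ with ∫ w dμ(w) = 0, such that w ↦ φ(x + w) is μ-integrable for every x and ∫ φ(2w) dμ(w) < ∞. Define φ_μ(x) = ∫ φ(x + w) dμ(w). Then liminf_{‖x‖₂→∞} (φ(x) − φ(0))/‖x‖₂ = liminf_{‖x‖₂→∞} (φ_μ(x) − φ_μ(0))/‖x‖₂. -/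
open MeasureTheory Filter

/-- A lower limit in `EReal` does not decrease under a real perturbation tending to zero. -/
theorem liminf_coe_le_of_eventually_le_add {α : Type*} {l : Filter α} [l.NeBot]
    {f g e : α → ℝ} (he : Tendsto e l (nhds 0)) (h : ∀ᶠ x in l, f x ≤ e x + g x) :
    liminf (fun x => (f x : EReal)) l ≤ liminf (fun x => (g x : EReal)) l := by
  have he' : limsup (fun x => (e x : EReal)) l = 0 :=
    ((continuous_coe_real_ereal.tendsto 0).comp he).limsup_eq
  calc liminf (fun x => (f x : EReal)) l
      ≤ liminf ((fun x => (e x : EReal)) + fun x => (g x : EReal)) l := by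
        refine liminf_le_liminf ?_
        filter_upwards [h] with x hx
        rw [Pi.add_apply, ← EReal.coe_add]
        exact EReal.coe_le_coe_iff.mpr hx
    _ ≤ limsup (fun x => (e x : EReal)) l + liminf (fun x => (g x : EReal)) l :=
        EReal.liminf_add_le (by simp [he']) (by simp [he'])
    _ = liminf (fun x => (g x : EReal)) l := by rw [he', zero_add]

/-- The filter of neighbourhoods of infinity is invariant under nonzero dilations. -/
theorem map_smul_comap_norm_atTop {E : Type*} [NormedAddCommGroup E] [NormedSpace ℝ E]
    {c : ℝ} (hc : c ≠ 0) :
    map (fun x : E => c • x) (comap (fun x : E => ‖x‖) atTop) =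
      comap (fun x : E => ‖x‖) atTop := by
  have key : ∀ a : ℝ, a ≠ 0 → Tendsto (fun x : E => a • x)
      (comap (fun x : E => ‖x‖) atTop) (comap (fun x : E => ‖x‖) atTop) := by
    intro a ha
    rw [tendsto_comap_iff]
    refine (tendsto_comap.const_mul_atTop (abs_pos.mpr ha)).congr fun x => ?_
    simp [norm_smul]
  refine le_antisymm (key c hc) ?_
  have := map_mono (m := fun x : E => c • x) (key c⁻¹ (inv_ne_zero hc))
  rwa [map_map, show ((fun x : E => c • x) ∘ fun x : E => c⁻¹ • x) = id from
    funext fun x => smul_inv_smul₀ hc x, map_id] at this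

/-- For `n ≥ 1` and `φ : ℝⁿ → ℝ` convex, even, coercive and nonnegative,
and a mean-zero probability measure `μ` with the stated integrability, the asymptotic
slope of `φ` equals that of its smoothed version `φ_μ`:
`liminf_{‖x‖→∞} (φ(x) − φ(0))/‖x‖ = liminf_{‖x‖→∞} (φ_μ(x) − φ_μ(0))/‖x‖`. -/
theorem stmt7 (n : ℕ) (hn : 1 ≤ n) (φ : EuclideanSpace ℝ (Fin n) → ℝ)
    (hconv : ConvexOn ℝ Set.univ φ)
    (heven : ∀ x : EuclideanSpace ℝ (Fin n), φ x = φ (-x))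
    (hcoercive : Filter.Tendsto φ
      (Filter.comap (fun x : EuclideanSpace ℝ (Fin n) => ‖x‖) Filter.atTop) Filter.atTop)
    (hnonneg : ∀ x : EuclideanSpace ℝ (Fin n), 0 ≤ φ x)
    (μ : Measure (EuclideanSpace ℝ (Fin n))) [IsProbabilityMeasure μ]
    (hid : Integrable (fun w : EuclideanSpace ℝ (Fin n) => w) μ)
    (hmean : ∫ w, w ∂μ = (0 : EuclideanSpace ℝ (Fin n)))
    (hint : ∀ x : EuclideanSpace ℝ (Fin n), Integrable (fun w => φ (x + w)) μ)
    (h2w : Integrable (fun w : EuclideanSpace ℝ (Fin n) => φ ((2 : ℝ) • w)) μ)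
    (φμ : EuclideanSpace ℝ (Fin n) → ℝ)
    (hφμ : ∀ x : EuclideanSpace ℝ (Fin n), φμ x = ∫ w, φ (x + w) ∂μ) :
    Filter.liminf
        (fun x : EuclideanSpace ℝ (Fin n) => (((φ x - φ 0) / ‖x‖ : ℝ) : EReal))
        (Filter.comap (fun x : EuclideanSpace ℝ (Fin n) => ‖x‖) Filter.atTop)
      = Filter.liminf
        (fun x : EuclideanSpace ℝ (Fin n) => (((φμ x - φμ 0) / ‖x‖ : ℝ) : EReal))
        (Filter.comap (fun x : EuclideanSpace ℝ (Fin n) => ‖x‖) Filter.atTop) := by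
  have : Nonempty (Fin n) := ⟨⟨0, hn⟩⟩
  have : (comap (fun x : EuclideanSpace ℝ (Fin n) => ‖x‖) atTop).NeBot := by
    rw [comap_norm_atTop]
    infer_instance
  have hsmall (C : ℝ) : Tendsto (fun x : EuclideanSpace ℝ (Fin n) => C / ‖x‖)
      (comap (fun x : EuclideanSpace ℝ (Fin n) => ‖x‖) atTop) (nhds 0) :=
    tendsto_comap.const_div_atTop C
  have hpos : ∀ᶠ x : EuclideanSpace ℝ (Fin n) in comap (fun x => ‖x‖) atTop, 0 < ‖x‖ :=
    tendsto_comap.eventually_gt_atTop 0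
  have hjensen (x : EuclideanSpace ℝ (Fin n)) : φ x ≤ φμ x := by
    have hcont : ContinuousOn φ Set.univ := hconv.continuousOn isOpen_univ
    have h := hconv.map_integral_le hcont isClosed_univ (μ := μ) (f := fun w => x + w)
      (by simp) ((integrable_const x).add hid) (hint x)
    rw [integral_add (integrable_const x) hid, hmean] at h
    simpa [hφμ] using h
  have hupper (x : EuclideanSpace ℝ (Fin n)) :
      φμ x ≤ (1 / 2) * φ ((2 : ℝ) • x) + (1 / 2) * ∫ w, φ ((2 : ℝ) • w) ∂μ := by
    have h : ∫ w, φ (x + w) ∂μ ≤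
        ∫ w, ((1 / 2) * φ ((2 : ℝ) • x) + (1 / 2) * φ ((2 : ℝ) • w)) ∂μ := by
      refine integral_mono (hint x) ((integrable_const _).add (h2w.const_mul _)) fun w => ?_
      have h := hconv.2 (Set.mem_univ ((2 : ℝ) • x)) (Set.mem_univ ((2 : ℝ) • w))
        (by norm_num : (0 : ℝ) ≤ 1 / 2) (by norm_num : (0 : ℝ) ≤ 1 / 2) (by norm_num)
      simpa [smul_smul] using h
    rw [integral_add (integrable_const _) (h2w.const_mul _)] at h
    simpa [hφμ, integral_const_mul] using h
  apply le_antisymm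
  · refine liminf_coe_le_of_eventually_le_add (hsmall (φμ 0 - φ 0)) ?_
    filter_upwards [hpos] with x hx
    rw [← add_div]
    gcongr
    linarith [hjensen x]
  · conv_rhs => rw [← map_smul_comap_norm_atTop (two_ne_zero (α := ℝ)), ← liminf_comp]
    refine liminf_coe_le_of_eventually_le_add
      (hsmall ((1 / 2) * φ 0 + (1 / 2) * (∫ w, φ ((2 : ℝ) • w) ∂μ) - φμ 0)) ?_
    filter_upwards [hpos] with x hx
    have hscale : (φ ((2 : ℝ) • x) - φ 0) / ‖(2 : ℝ) • x‖ =
        ((1 / 2) * φ ((2 : ℝ) • x) - (1 / 2) * φ 0) / ‖x‖ := by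
      rw [norm_smul, Real.norm_ofNat]
      field_simp
    rw [hscale, ← add_div]
    gcongr
    linarith [hupper x]
end

section
/- Let w be a real-valued integrable random variable with E[w] = 0, and let σ > 0 be such that P(w > s) ≤ exp(−s²/(2σ²)) for all s ≥ 0. Then for every α > 0, E[w · 1{w ≤ ασ}] ≥ −σ·(α + 1/α)·exp(−α²/2). -/
open MeasureTheory

/-- Sub-Gaussian tails bound the mean excess over a positive level `s`. -/
theorem integral_max_sub_le_of_subGaussian_tail {Ω : Type*} [MeasurableSpace Ω] {μ : Measure Ω}
    [IsFiniteMeasure μ] {w : Ω → ℝ} (hint : Integrable w μ) {σ s : ℝ} (hσ : 0 < σ) (hs : 0 < s)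
    (htail : ∀ t : ℝ, 0 ≤ t → μ.real {ω | t < w ω} ≤ Real.exp (-(t ^ 2) / (2 * σ ^ 2))) :
    ∫ ω, max (w ω - s) 0 ∂μ ≤ σ ^ 2 / s * Real.exp (-(s ^ 2) / (2 * σ ^ 2)) := by
  have hneg : -(s / σ ^ 2) < 0 := neg_lt_zero.mpr (by positivity)
  have hf : Integrable (fun ω => max (w ω - s) 0) μ := (hint.sub (integrable_const s)).pos_part
  rw [hf.integral_eq_integral_meas_lt (ae_of_all _ fun ω => le_max_right _ _)]
  calc ∫ t in Set.Ioi (0 : ℝ), μ.real {ω | t < max (w ω - s) 0}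
      ≤ ∫ t in Set.Ioi (0 : ℝ),
          Real.exp (-(s ^ 2) / (2 * σ ^ 2)) * Real.exp (-(s / σ ^ 2) * t) := by
        refine integral_mono_of_nonneg (ae_of_all _ fun t => measureReal_nonneg)
          ((integrableOn_exp_mul_Ioi hneg 0).const_mul _) ?_
        filter_upwards [ae_restrict_mem measurableSet_Ioi] with t ht
        have ht : 0 < t := ht
        have hset : {ω | t < max (w ω - s) 0} = {ω | s + t < w ω} := by
          ext ω
          simp [ht.not_gt, lt_sub_iff_add_lt']
        rw [hset, ← Real.exp_add]
        refine (htail (s + t) (by positivity)).trans (Real.exp_le_exp.mpr ?_)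
        have hsplit : -(s ^ 2) / (2 * σ ^ 2) + -(s / σ ^ 2) * t
            = -(s ^ 2 + 2 * s * t) / (2 * σ ^ 2) := by
          field_simp
          ring
        rw [hsplit]
        gcongr
        nlinarith [sq_nonneg t]
    _ = σ ^ 2 / s * Real.exp (-(s ^ 2) / (2 * σ ^ 2)) := by
        rw [integral_const_mul, integral_exp_mul_Ioi hneg]
        simp
        ring

/-- For an integrable zero-mean real random variable `w` with sub-Gaussian
upper tail `P(w > s) ≤ exp(−s²/(2σ²))` for `s ≥ 0`, the truncated expectation satisfies
`E[w·1{w ≤ ασ}] ≥ −σ(α + 1/α)exp(−α²/2)` for every `α > 0`. -/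
theorem stmt12 {Ω : Type*} [MeasurableSpace Ω] (μ : Measure Ω) [IsProbabilityMeasure μ]
    (w : Ω → ℝ) (hint : Integrable w μ) (hmean : ∫ ω, w ω ∂μ = 0)
    (σ : ℝ) (hσ : 0 < σ)
    (htail : ∀ s : ℝ, 0 ≤ s →
      μ {ω | s < w ω} ≤ ENNReal.ofReal (Real.exp (-(s ^ 2) / (2 * σ ^ 2))))
    (α : ℝ) (hα : 0 < α) :
    -(σ * (α + 1 / α) * Real.exp (-(α ^ 2) / 2))
      ≤ ∫ ω in {ω | w ω ≤ α * σ}, w ω ∂μ := by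
  have htail' : ∀ t : ℝ, 0 ≤ t → μ.real {ω | t < w ω} ≤ Real.exp (-(t ^ 2) / (2 * σ ^ 2)) :=
    fun t ht => ENNReal.toReal_le_of_le_ofReal (Real.exp_pos _).le (htail t ht)
  have hs : 0 < α * σ := by positivity
  have hexp : -((α * σ) ^ 2) / (2 * σ ^ 2) = -(α ^ 2) / 2 := by
    field_simp
  have hexcess := integral_max_sub_le_of_subGaussian_tail hint hσ hs htail'
  have hprob := htail' (α * σ) hs.le
  rw [hexp] at hexcess hprob
  have hmeas : NullMeasurableSet {ω | w ω ≤ α * σ} μ :=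
    nullMeasurableSet_le hint.aemeasurable aemeasurable_const
  have hmeas' : NullMeasurableSet {ω | α * σ < w ω} μ :=
    nullMeasurableSet_lt aemeasurable_const hint.aemeasurable
  have hf : Integrable (fun ω => max (w ω - α * σ) 0) μ :=
    (hint.sub (integrable_const _)).pos_part
  have hind : Integrable ({ω | α * σ < w ω}.indicator fun _ => α * σ) μ :=
    (integrable_const _).indicator₀ hmeas'
  have hdecomp : {ω | w ω ≤ α * σ}.indicator w =
      w - {ω | α * σ < w ω}.indicator (fun _ => α * σ) - fun ω => max (w ω - α * σ) 0 := by
    ext ω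
    rcases le_or_gt (w ω) (α * σ) with h | h
    · simp [h, h.not_gt]
    · simp [h, h.not_ge, h.le]
  rw [← integral_indicator₀ hmeas, hdecomp, integral_sub' (hint.sub hind) hf,
    integral_sub' hint hind, hmean, integral_indicator₀ hmeas', setIntegral_const, smul_eq_mul]
  have hcoeff : σ ^ 2 / (α * σ) = σ * (1 / α) := by
    field_simp
  rw [hcoeff] at hexcess
  nlinarith [mul_le_mul_of_nonneg_right hprob hs.le]
end

section
/- Let w be a real-valued integrable random variable with E[w] = 0, and let σ > 0 be such that P(w > s) ≤ exp(−s²/(2σ²)) for all s ≥ 0. Let α > 0 and suppose P(w ≤ ασ) ≥ 1/2. Then E[w · 1{w ≤ ασ}] / P(w ≤ ασ) ≥ −2σ·(α + 1/α)·exp(−α²/2); that is, the conditional expectation of w given the event {w ≤ ασ} is at least −2σ(α + 1/α)e^{−α²/2}. -/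
open MeasureTheory

/-- If the upper tail of `w` beyond `c` decays at least like `A * exp (-(b * t))`, then the mean
excess of `w` over `c` is at most `A / b`. -/
theorem integral_max_sub_le_of_tail_le {Ω : Type*} [MeasurableSpace Ω] {μ : Measure Ω}
    [IsFiniteMeasure μ] {w : Ω → ℝ} (hint : Integrable w μ) {A b c : ℝ} (hb : 0 < b)
    (htail : ∀ t : ℝ, 0 < t → μ.real {ω | c + t < w ω} ≤ A * Real.exp (-b * t)) :
    ∫ ω, max (w ω - c) 0 ∂μ ≤ A / b := by
  have hmax : Integrable (fun ω => max (w ω - c) 0) μ :=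
    (hint.sub (integrable_const c)).pos_part
  rw [hmax.integral_eq_integral_meas_lt (.of_forall fun _ => le_max_right _ _)]
  calc ∫ t in Set.Ioi (0 : ℝ), μ.real {ω | t < max (w ω - c) 0}
      ≤ ∫ t in Set.Ioi (0 : ℝ), A * Real.exp (-b * t) := by
        refine integral_mono_of_nonneg (.of_forall fun _ => measureReal_nonneg)
          ((integrableOn_exp_mul_Ioi (neg_lt_zero.mpr hb) 0).const_mul A) ?_
        filter_upwards [ae_restrict_mem measurableSet_Ioi] with t (ht : 0 < t)
        convert! htail t ht using 3
        ext ω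
        simp [ht.not_gt, lt_sub_iff_add_lt']
    _ = A / b := by
        rw [integral_const_mul, integral_exp_mul_Ioi (neg_lt_zero.mpr hb)]
        simp [div_eq_mul_inv]

/-- For an integrable zero-mean real random variable `w` with sub-Gaussian
upper tail `P(w > s) ≤ exp(−s²/(2σ²))` for `s ≥ 0`, if `P(w ≤ ασ) ≥ 1/2` then the
conditional expectation of `w` given `{w ≤ ασ}` is at least `−2σ(α + 1/α)exp(−α²/2)`. -/
theorem stmt13 {Ω : Type*} [MeasurableSpace Ω] (μ : Measure Ω) [IsProbabilityMeasure μ]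
    (w : Ω → ℝ) (hint : Integrable w μ) (hmean : ∫ ω, w ω ∂μ = 0)
    (σ : ℝ) (hσ : 0 < σ)
    (htail : ∀ s : ℝ, 0 ≤ s →
      μ {ω | s < w ω} ≤ ENNReal.ofReal (Real.exp (-(s ^ 2) / (2 * σ ^ 2))))
    (α : ℝ) (hα : 0 < α)
    (hhalf : (1 : ENNReal) / 2 ≤ μ {ω | w ω ≤ α * σ}) :
    -(2 * σ * (α + 1 / α) * Real.exp (-(α ^ 2) / 2))
      ≤ (∫ ω in {ω | w ω ≤ α * σ}, w ω ∂μ) / (μ {ω | w ω ≤ α * σ}).toReal := by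
  have hσ2 : σ ≠ 0 := hσ.ne'
  have htail_real (s : ℝ) (hs : 0 ≤ s) :
      μ.real {ω | s < w ω} ≤ Real.exp (-(s ^ 2) / (2 * σ ^ 2)) :=
    ENNReal.toReal_le_of_le_ofReal (Real.exp_pos _).le (htail s hs)
  have hexcess : ∫ ω, max (w ω - α * σ) 0 ∂μ ≤ Real.exp (-(α ^ 2) / 2) / (α / σ) := by
    refine integral_max_sub_le_of_tail_le hint (div_pos hα hσ) fun t ht => ?_
    refine (htail_real _ (by positivity)).trans ?_
    rw [← Real.exp_add]
    gcongr
    have h : -(α ^ 2) / 2 + -(α / σ) * t - -((α * σ + t) ^ 2) / (2 * σ ^ 2)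
        = t ^ 2 / (2 * σ ^ 2) := by
      field_simp
      ring
    have : 0 ≤ t ^ 2 / (2 * σ ^ 2) := by positivity
    linarith
  have hmax : Integrable (fun ω => max (w ω - α * σ) 0) μ :=
    (hint.sub (integrable_const _)).pos_part
  set S := {ω | w ω ≤ α * σ} with hS
  have hnull : NullMeasurableSet S μ :=
    nullMeasurableSet_le hint.aemeasurable aemeasurable_const
  have hcompl : μ.real Sᶜ ≤ Real.exp (-(α ^ 2) / 2) := by
    have h := htail_real (α * σ) (by positivity)
    rw [show -((α * σ) ^ 2) / (2 * σ ^ 2) = -(α ^ 2) / 2 by field_simp] at h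
    simpa [hS, Set.compl_ofPred] using h
  have hupper : ∫ ω in Sᶜ, w ω ∂μ ≤ σ * (α + 1 / α) * Real.exp (-(α ^ 2) / 2) := by
    calc ∫ ω in Sᶜ, w ω ∂μ
        ≤ ∫ ω in Sᶜ, (α * σ + max (w ω - α * σ) 0) ∂μ := by
          refine integral_mono hint.integrableOn
            ((integrable_const _).add hmax.integrableOn) fun ω => ?_
          have := le_max_left (w ω - α * σ) 0
          simp only
          linarith
      _ = μ.real Sᶜ * (α * σ) + ∫ ω in Sᶜ, max (w ω - α * σ) 0 ∂μ := by
          rw [integral_add (integrable_const _) hmax.integrableOn, setIntegral_const, smul_eq_mul]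
      _ ≤ Real.exp (-(α ^ 2) / 2) * (α * σ) + Real.exp (-(α ^ 2) / 2) / (α / σ) := by
          gcongr
          exact (setIntegral_le_integral hmax (.of_forall fun _ => le_max_right _ _)).trans hexcess
      _ = σ * (α + 1 / α) * Real.exp (-(α ^ 2) / 2) := by
          field_simp
  have hsplit := integral_add_compl₀ hnull hint
  rw [hmean] at hsplit
  have hp : (1 : ℝ) / 2 ≤ (μ S).toReal := by
    simpa using ENNReal.toReal_mono (measure_ne_top μ S) hhalf
  rw [le_div_iff₀ (by linarith)]
  have hB : 0 ≤ σ * (α + 1 / α) * Real.exp (-(α ^ 2) / 2) := by positivity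
  nlinarith [mul_le_mul_of_nonneg_left hp hB]
end
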